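/- Let n ≥ 5 and let p_1, …, p_n ∈ ℝ² (indices mod n) be in strictly convex position in counterclockwise order, with P their convex hull. If for every index i the sum of the interior angles of P at p_i and at p_{i+1} is greater than π, then the set of areas of convex polygons circumscribed about P is bounded above: there exists M ∈ ℝ such that every convex polygon Q circumscribed about P has area(Q) ≤ M. -/

import Mathlib

open MeasureTheory EuclideanGeometry

noncomputable section

/-- The plane. -/
abbrev E2 := EuclideanSpace ℝ (Fin 2)

/-- Cross product of two planar vectors. -/
def cross2 (u v : E2) : ℝ := u 0 * v 1 - u 1 * v 0

/-- A convex polygon: the convex hull of a finite set of points. -/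
def IsConvexPolygon (Q : Set E2) : Prop := ∃ F : Finset E2, Q = convexHull ℝ (F : Set E2)

theorem inner_eq_coord (u v : E2) : inner ℝ u v = u 0 * v 0 + u 1 * v 1 := by
  simp [PiLp.inner_apply, Fin.sum_univ_two, mul_comm]

/-- A vector lying strictly between two others, of total opening less than `π`, witnesses that they
are positively oriented. -/
theorem cross2_pos_of_angle_add_angle_lt_pi {a b c : E2} (hab : 0 < cross2 a b)
    (hbc : 0 < cross2 b c)
    (h : InnerProductGeometry.angle a b + InnerProductGeometry.angle b c < Real.pi) :
    0 < cross2 a c := by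
  have sin_mul {x y : E2} (hxy : 0 < cross2 x y) :
      Real.sin (InnerProductGeometry.angle x y) * (‖x‖ * ‖y‖) = cross2 x y := by
    rw [InnerProductGeometry.sin_angle_mul_norm_mul_norm, ← Real.sqrt_sq hxy.le]
    congr 1
    simp only [inner_eq_coord, cross2]
    ring
  have sin_pos {x y : E2} (hxy : 0 < cross2 x y) :
      0 < Real.sin (InnerProductGeometry.angle x y) :=
    pos_of_mul_pos_left ((sin_mul hxy).symm ▸ hxy) (by positivity)
  have angle_pos {x y : E2} (hxy : 0 < cross2 x y) : 0 < InnerProductGeometry.angle x y := by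
    refine (InnerProductGeometry.angle_nonneg x y).lt_of_ne fun h0 => ?_
    have := sin_pos hxy
    simp [← h0] at this
  have hb : b ≠ 0 := by
    rintro rfl
    simp [cross2] at hab
  have ha : a ≠ 0 := by
    rintro rfl
    simp [cross2] at hab
  have hc : c ≠ 0 := by
    rintro rfl
    simp [cross2] at hbc
  have hpos := Real.sin_pos_of_pos_of_lt_pi (add_pos (angle_pos hab) (angle_pos hbc)) h
  rw [Real.sin_add] at hpos
  have hprod := mul_pos hpos (show 0 < (‖a‖ * ‖b‖) * (‖b‖ * ‖c‖) by positivity)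
  have hid : (Real.sin (InnerProductGeometry.angle a b) * Real.cos (InnerProductGeometry.angle b c)
      + Real.cos (InnerProductGeometry.angle a b) * Real.sin (InnerProductGeometry.angle b c))
      * ((‖a‖ * ‖b‖) * (‖b‖ * ‖c‖)) = inner ℝ b b * cross2 a c := by
    calc _ = (Real.sin (InnerProductGeometry.angle a b) * (‖a‖ * ‖b‖))
            * (Real.cos (InnerProductGeometry.angle b c) * (‖b‖ * ‖c‖))
          + (Real.cos (InnerProductGeometry.angle a b) * (‖a‖ * ‖b‖))
            * (Real.sin (InnerProductGeometry.angle b c) * (‖b‖ * ‖c‖)) := by ring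
      _ = cross2 a b * inner ℝ b c + inner ℝ a b * cross2 b c := by
        rw [sin_mul hab, sin_mul hbc, InnerProductGeometry.cos_angle_mul_norm_mul_norm,
          InnerProductGeometry.cos_angle_mul_norm_mul_norm]
      _ = _ := by
        simp only [inner_eq_coord, cross2]
        ring
  rw [hid] at hprod
  exact pos_of_mul_pos_right hprod real_inner_self_nonneg

/-- If `u` is a nonzero outer normal at a corner with incoming edge `a` and outgoing edge `b`, and
`d` does not point out of the supporting half-plane, then `a` and `b` are not both strictly to the
left of `d`. -/
theorem not_both_left_of_outer_normal {a b u d : E2} (hab : 0 < cross2 a b) (hu : u ≠ 0)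
    (ha : 0 ≤ (inner ℝ u a : ℝ)) (hb : (inner ℝ u b : ℝ) ≤ 0) (hd : (inner ℝ u d : ℝ) ≤ 0)
    (hda : 0 < cross2 d a) : cross2 d b ≤ 0 := by
  by_contra! hdb
  have key : cross2 a b * inner ℝ u d = -inner ℝ u b * cross2 d a + inner ℝ u a * cross2 d b := by
    simp only [inner_eq_coord, cross2]
    ring
  have h1 := mul_nonpos_of_nonneg_of_nonpos hab.le hd
  have h2 := mul_nonneg (neg_nonneg.2 hb) hda.le
  have h3 := mul_nonneg ha hdb.le
  have hb0 : (inner ℝ u b : ℝ) = 0 := by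
    have : -(inner ℝ u b : ℝ) * cross2 d a = 0 := by linarith
    simpa [hda.ne'] using this
  have ha0 : (inner ℝ u a : ℝ) = 0 := by
    have : (inner ℝ u a : ℝ) * cross2 d b = 0 := by linarith
    simpa [hdb.ne'] using this
  rw [inner_eq_coord] at ha0 hb0
  have e0 : cross2 a b * u 0 = 0 := by
    unfold cross2
    linear_combination b 1 * ha0 - a 1 * hb0
  have e1 : cross2 a b * u 1 = 0 := by
    unfold cross2
    linear_combination a 0 * hb0 - b 0 * ha0
  apply hu
  ext k
  fin_cases k
  · simpa [hab.ne'] using e0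
  · simpa [hab.ne'] using e1

/-- Supporting half-planes at the vertices of a closed polygon whose consecutive and
next-to-consecutive edges are positively oriented have no common recession direction. -/
theorem exists_inner_outer_normal_pos {n : ℕ} [NeZero n] {p : ZMod n → E2}
    (h1 : ∀ i : ZMod n, 0 < cross2 (p (i + 1) - p i) (p (i + 2) - p (i + 1)))
    (h2 : ∀ i : ZMod n, 0 < cross2 (p (i + 1) - p i) (p (i + 3) - p (i + 2)))
    {u : ZMod n → E2} (hu : ∀ i, u i ≠ 0) (hup : ∀ i j, (inner ℝ (u i) (p j - p i) : ℝ) ≤ 0)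
    {d : E2} (hd : d ≠ 0) : ∃ i, 0 < (inner ℝ (u i) d : ℝ) := by
  by_contra! hud
  have step : ∀ i, 0 < cross2 d (p (i + 1) - p i) → cross2 d (p (i + 2) - p (i + 1)) ≤ 0 := by
    intro i hi
    refine not_both_left_of_outer_normal (h1 i) (hu (i + 1)) ?_ (hup _ _) (hud _) hi
    have := hup (i + 1) i
    rw [← neg_sub, inner_neg_right] at this
    linarith
  have hnonpos : ∀ i, cross2 d (p (i + 1) - p i) ≤ 0 := by
    intro i
    by_contra! hi
    have hnext := step i hi
    have hprev : cross2 d (p i - p (i - 1)) ≤ 0 := by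
      by_contra! hneg
      have := step (i - 1) (by simpa using hneg)
      rw [show i - 1 + 2 = i + 1 by ring, show i - 1 + 1 = i by ring] at this
      linarith
    have c1 := h1 (i - 1)
    have c2 := h1 i
    have c3 := h2 (i - 1)
    rw [show i - 1 + 1 = i by ring, show i - 1 + 2 = i + 1 by ring] at c1
    rw [show i - 1 + 1 = i by ring, show i - 1 + 2 = i + 1 by ring,
      show i - 1 + 3 = i + 2 by ring] at c3
    generalize p i - p (i - 1) = a at *
    generalize p (i + 1) - p i = b at *
    generalize p (i + 2) - p (i + 1) = c at *
    have key : cross2 a c * cross2 d b = cross2 b c * cross2 d a + cross2 a b * cross2 d c := by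
      unfold cross2
      ring
    linarith [mul_pos c3 hi, mul_nonpos_of_nonneg_of_nonpos c2.le hprev,
      mul_nonpos_of_nonneg_of_nonpos c1.le hnext]
  have hsum : ∑ i, cross2 d (p (i + 1) - p i) = 0 := by
    have : ∀ i, cross2 d (p (i + 1) - p i) = cross2 d (p (i + 1)) - cross2 d (p i) := by
      intro i
      simp only [cross2, PiLp.sub_apply]
      ring
    simp only [this, Finset.sum_sub_distrib]
    exact sub_eq_zero.2 (Equiv.sum_comp (Equiv.addRight (1 : ZMod n)) fun i => cross2 d (p i))
  have hzero : ∀ i, cross2 d (p (i + 1) - p i) = 0 := fun i =>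
    (Finset.sum_eq_zero_iff_of_nonpos fun j _ => hnonpos j).1 hsum i (Finset.mem_univ i)
  have c := h1 0
  have z1 := hzero 0
  have z2 := hzero (0 + 1)
  rw [show (0 : ZMod n) + 1 + 1 = 0 + 2 by ring] at z2
  generalize p (0 + 1) - p 0 = a at *
  generalize p (0 + 2) - p (0 + 1) = b at *
  unfold cross2 at c z1 z2
  have e0 : (a 0 * b 1 - a 1 * b 0) * d 0 = 0 := by linear_combination a 0 * z2 - b 0 * z1
  have e1 : (a 0 * b 1 - a 1 * b 0) * d 1 = 0 := by linear_combination a 1 * z2 - b 1 * z1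
  apply hd
  ext k
  fin_cases k
  · simpa [c.ne'] using e0
  · simpa [c.ne'] using e1

/-- A convex set with nonempty interior has a unit outer normal at each frontier point. -/
theorem exists_unit_outer_normal {Q : Set E2} (hQ : Convex ℝ Q) (hne : (interior Q).Nonempty)
    {x : E2} (hx : x ∈ frontier Q) :
    ∃ u : E2, ‖u‖ = 1 ∧ ∀ q ∈ Q, (inner ℝ u (q - x) : ℝ) ≤ 0 := by
  obtain ⟨f, hf⟩ := geometric_hahn_banach_open_point hQ.interior isOpen_interior hx.2
  obtain ⟨y, hy⟩ := hne
  have hf0 : (InnerProductSpace.toDual ℝ E2).symm f ≠ 0 := by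
    intro h0
    have hf0 : f = 0 := by simpa using h0
    simpa [hf0] using hf y hy
  set v := (InnerProductSpace.toDual ℝ E2).symm f with hv
  have hfv : ∀ z, inner ℝ v z = f z := fun z => InnerProductSpace.toDual_symm_apply
  have hle : ∀ q ∈ Q, f q ≤ f x := by
    intro q hq
    have hcl : q ∈ closure (interior Q) := by
      rw [hQ.closure_interior_eq_closure_of_nonempty_interior ⟨y, hy⟩]
      exact subset_closure hq
    exact closure_minimal (fun a ha => (hf a ha).le)
      (isClosed_le f.continuous continuous_const) hcl
  refine ⟨(‖v‖)⁻¹ • v, norm_smul_inv_norm hf0, fun q hq => ?_⟩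
  rw [real_inner_smul_left, hfv, map_sub]
  exact mul_nonpos_of_nonneg_of_nonpos (by positivity) (sub_nonpos.2 (hle q hq))

/-- If no choice of supporting half-planes at the points `p i` has a common recession direction,
then convex sets with nonempty interior having every `p i` on the frontier are uniformly bounded. -/
theorem exists_subset_closedBall_of_outer_normals {ι : Type*} [Fintype ι] {p : ι → E2}
    (h : ∀ u : ι → E2, (∀ i, u i ≠ 0) → (∀ i j, (inner ℝ (u i) (p j - p i) : ℝ) ≤ 0) →
      ∀ d : E2, d ≠ 0 → ∃ i, 0 < (inner ℝ (u i) d : ℝ)) :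
    ∃ R : ℝ, ∀ Q : Set E2, Convex ℝ Q → (interior Q).Nonempty → (∀ i, p i ∈ Q) →
      (∀ i, p i ∈ frontier Q) → Q ⊆ Metric.closedBall 0 R := by
  let C : Set ((ι → E2) × E2) :=
    ((Set.univ.pi fun _ => Metric.sphere 0 1) ×ˢ Metric.sphere 0 1) ∩
      {w | ∀ i j, (inner ℝ (w.1 i) (p j - p i) : ℝ) ≤ 0}
  let g : (ι → E2) × E2 → ℝ := fun w => ∑ i, max 0 (inner ℝ (w.1 i) w.2)
  have hC : IsCompact C := by
    refine ((isCompact_univ_pi fun _ => isCompact_sphere 0 1).prod (isCompact_sphere 0 1)).inter_right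
      ?_
    simp only [Set.ofPred_forall]
    exact isClosed_iInter fun i => isClosed_iInter fun j =>
      isClosed_le (by fun_prop) continuous_const
  have hg : Continuous g := by fun_prop
  have hgpos : ∀ w ∈ C, 0 < g w := by
    rintro ⟨u, d⟩ ⟨⟨hu, hd⟩, hup⟩
    obtain ⟨i, hi⟩ := h u (fun i => ne_zero_of_mem_unit_sphere ⟨u i, hu i trivial⟩) hup d
      (ne_zero_of_mem_unit_sphere ⟨d, hd⟩)
    exact Finset.sum_pos' (fun _ _ => le_max_left _ _) ⟨i, Finset.mem_univ i, lt_max_of_lt_right hi⟩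
  obtain ⟨ε, hε, hεg⟩ : ∃ ε > 0, ∀ w ∈ C, ε ≤ g w := hC.exists_forall_le' hg.continuousOn hgpos
  refine ⟨(∑ i, ‖p i‖) / ε, fun Q hQ hne hpQ hfr q hq => ?_⟩
  rw [mem_closedBall_zero_iff, le_div_iff₀ hε]
  rcases eq_or_ne q 0 with rfl | hq0
  · simpa using Finset.sum_nonneg fun i _ => norm_nonneg (p i)
  choose u hu hsupp using fun i => exists_unit_outer_normal hQ hne (hfr i)
  have hmem : (u, ‖q‖⁻¹ • q) ∈ C :=
    ⟨⟨fun i _ => mem_sphere_zero_iff_norm.2 (hu i),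
      mem_sphere_zero_iff_norm.2 (norm_smul_inv_norm hq0)⟩, fun i j => hsupp i _ (hpQ j)⟩
  calc ‖q‖ * ε ≤ ‖q‖ * g (u, ‖q‖⁻¹ • q) := by gcongr; exact hεg _ hmem
    _ = ∑ i, ‖q‖ * max 0 (inner ℝ (u i) (‖q‖⁻¹ • q)) := Finset.mul_sum _ _ _
    _ ≤ ∑ i, ‖p i‖ := by
      refine Finset.sum_le_sum fun i _ => ?_
      rw [mul_max_of_nonneg _ _ (norm_nonneg q), mul_zero, real_inner_smul_right,
        mul_inv_cancel_left₀ (norm_ne_zero_iff.2 hq0)]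
      refine max_le (norm_nonneg _) ?_
      have hs := hsupp i q hq
      rw [inner_sub_right] at hs
      have hn := real_inner_le_norm (u i) (p i)
      rw [hu i, one_mul] at hn
      linarith

theorem stmt10 (n : ℕ) (hn : 5 ≤ n) (p : ZMod n → E2)
    (hccw : ∀ i : ZMod n, 0 < cross2 (p (i + 1) - p i) (p (i + 2) - p (i + 1)))
    (hangle : ∀ i : ZMod n,
      Real.pi < ∠ (p (i - 1)) (p i) (p (i + 1)) + ∠ (p i) (p (i + 1)) (p (i + 2))) :
    ∃ M : ℝ, ∀ Q : Set E2, IsConvexPolygon Q → convexHull ℝ (Set.range p) ⊆ Q →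
      (∀ i : ZMod n, p i ∈ frontier Q) → (volume Q).toReal ≤ M := by
  have : NeZero n := ⟨by omega⟩
  have hskip : ∀ i : ZMod n, 0 < cross2 (p (i + 1) - p i) (p (i + 3) - p (i + 2)) := by
    intro i
    have c := hccw (i + 1)
    have ha := hangle (i + 1)
    rw [show i + 1 + 1 = i + 2 by ring, show i + 1 + 2 = i + 3 by ring] at c ha
    rw [show i + 1 - 1 = i by ring] at ha
    refine cross2_pos_of_angle_add_angle_lt_pi (hccw i) c ?_
    unfold EuclideanGeometry.angle at ha
    simp only [vsub_eq_sub] at ha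
    rw [← neg_sub (p (i + 1)) (p i), ← neg_sub (p (i + 2)) (p (i + 1)),
      InnerProductGeometry.angle_neg_left, InnerProductGeometry.angle_neg_left] at ha
    linarith
  obtain ⟨R, hR⟩ := exists_subset_closedBall_of_outer_normals fun u hu hup d hd =>
    exists_inner_outer_normal_pos hccw hskip hu hup hd
  refine ⟨(volume (Metric.closedBall (0 : E2) R)).toReal, fun Q hQ hPQ hfr => ?_⟩
  have hconv : Convex ℝ Q := by
    obtain ⟨F, rfl⟩ := hQ
    exact convex_convexHull ℝ _
  rcases (interior Q).eq_empty_or_nonempty with hint | hint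
  · have hQ0 : volume Q = 0 := by
      refine measure_mono_null (fun q hq => ?_) (hconv.addHaar_frontier volume)
      exact ⟨subset_closure hq, by simp [hint]⟩
    rw [hQ0]
    exact ENNReal.toReal_nonneg
  · exact ENNReal.toReal_mono measure_closedBall_lt_top.ne <| measure_mono <|
      hR Q hconv hint (fun i => hPQ (subset_convexHull ℝ _ ⟨i, rfl⟩)) hfr
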